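/- Assume 0 < κ ≤ a and ξ ∈ J_{a,κ,τ}. Then for every smooth solution (u,θ) of the thermoelastic string with delayed heat conduction, the energy t ↦ E(t) is nonincreasing on [0,∞). -/

import Mathlib

open MeasureTheory intervalIntegral

/-- Partial derivative in the space variable of `f : ℝ → ℝ → ℝ` (first argument). -/
noncomputable def pdX (f : ℝ → ℝ → ℝ) (x t : ℝ) : ℝ := deriv (fun y => f y t) x

/-- Partial derivative in the time variable of `f : ℝ → ℝ → ℝ` (second argument). -/
noncomputable def pdT (f : ℝ → ℝ → ℝ) (x t : ℝ) : ℝ := deriv (fun s => f x s) t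

/-- A smooth solution of the thermoelastic string with delayed heat conduction:
`u_tt − u_xx + θ_x = 0`, `θ_t − κ·θ_xx(·,·−τ) − a·θ_xx + u_tx = 0` on `(0,L)×(0,∞)`,
with Dirichlet boundary conditions. -/
structure IsSmoothSolDelayedHeatString (L τ a κ : ℝ) (u θ : ℝ → ℝ → ℝ) : Prop where
  smooth_u : ContDiff ℝ (⊤ : ℕ∞) (fun p : ℝ × ℝ => u p.1 p.2)
  smooth_θ : ContDiff ℝ (⊤ : ℕ∞) (fun p : ℝ × ℝ => θ p.1 p.2)
  pde_u : ∀ x ∈ Set.Ioo (0 : ℝ) L, ∀ t > (0 : ℝ),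
    pdT (pdT u) x t - pdX (pdX u) x t + pdX θ x t = 0
  pde_θ : ∀ x ∈ Set.Ioo (0 : ℝ) L, ∀ t > (0 : ℝ),
    pdT θ x t - κ * pdX (pdX θ) x (t - τ) - a * pdX (pdX θ) x t + pdX (pdT u) x t = 0
  bc_u : ∀ t : ℝ, 0 ≤ t → u 0 t = 0 ∧ u L t = 0
  bc_θ : ∀ t : ℝ, -τ ≤ t → θ 0 t = 0 ∧ θ L t = 0

/-- The energy of the thermoelastic string with delayed heat conduction. -/
noncomputable def energyDHString (L τ ξ : ℝ) (u θ : ℝ → ℝ → ℝ) (t : ℝ) : ℝ :=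
  (1 / 2) * ((∫ x in (0 : ℝ)..L, ((pdT u x t) ^ 2 + (pdX u x t) ^ 2 + (θ x t) ^ 2))
    + ξ * ∫ x in (0 : ℝ)..L, ∫ ρ in (0 : ℝ)..(1 : ℝ), (pdX θ x (t - τ * ρ)) ^ 2)

abbrev SmoothTwo (f : ℝ → ℝ → ℝ) : Prop := ContDiff ℝ (⊤ : ℕ∞) (fun p : ℝ × ℝ => f p.1 p.2)

lemma hasX {f : ℝ → ℝ → ℝ} (h : SmoothTwo f) (x t : ℝ) :
    HasDerivAt (fun y => f y t) (fderiv ℝ (fun p : ℝ × ℝ => f p.1 p.2) (x, t) (1, 0)) x := by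
  have h1 : HasFDerivAt (fun p : ℝ × ℝ => f p.1 p.2) _ (x, t) :=
    ((h.differentiable (by simp)) (x, t)).hasFDerivAt
  have h2 : HasDerivAt (fun y : ℝ => (y, t)) ((1 : ℝ), (0 : ℝ)) x :=
    (hasDerivAt_id x).prodMk (hasDerivAt_const x t)
  exact h1.comp_hasDerivAt x h2

lemma hasT {f : ℝ → ℝ → ℝ} (h : SmoothTwo f) (x t : ℝ) :
    HasDerivAt (fun s => f x s) (fderiv ℝ (fun p : ℝ × ℝ => f p.1 p.2) (x, t) (0, 1)) t := by
  have h1 : HasFDerivAt (fun p : ℝ × ℝ => f p.1 p.2) _ (x, t) :=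
    ((h.differentiable (by simp)) (x, t)).hasFDerivAt
  have h2 : HasDerivAt (fun y : ℝ => (x, y)) ((0 : ℝ), (1 : ℝ)) t :=
    (hasDerivAt_const t x).prodMk (hasDerivAt_id t)
  exact h1.comp_hasDerivAt t h2

lemma pdX_eq {f : ℝ → ℝ → ℝ} (h : SmoothTwo f) (x t : ℝ) :
    pdX f x t = fderiv ℝ (fun p : ℝ × ℝ => f p.1 p.2) (x, t) (1, 0) := (hasX h x t).deriv

lemma pdT_eq {f : ℝ → ℝ → ℝ} (h : SmoothTwo f) (x t : ℝ) :
    pdT f x t = fderiv ℝ (fun p : ℝ × ℝ => f p.1 p.2) (x, t) (0, 1) := (hasT h x t).deriv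

lemma hasPdX {f : ℝ → ℝ → ℝ} (h : SmoothTwo f) (x t : ℝ) :
    HasDerivAt (fun y => f y t) (pdX f x t) x := by
  rw [pdX_eq h]; exact hasX h x t

lemma hasPdT {f : ℝ → ℝ → ℝ} (h : SmoothTwo f) (x t : ℝ) :
    HasDerivAt (fun s => f x s) (pdT f x t) t := by
  rw [pdT_eq h]; exact hasT h x t

lemma smooth_fderiv {f : ℝ → ℝ → ℝ} (h : SmoothTwo f) :
    ContDiff ℝ (⊤ : ℕ∞) (fderiv ℝ (fun p : ℝ × ℝ => f p.1 p.2)) :=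
  ContDiff.fderiv_right h (by simp)

lemma smooth_pdX {f : ℝ → ℝ → ℝ} (h : SmoothTwo f) : SmoothTwo (pdX f) := by
  have : (fun p : ℝ × ℝ => pdX f p.1 p.2) =
      fun p => fderiv ℝ (fun p : ℝ × ℝ => f p.1 p.2) p (1, 0) := by
    funext p; exact pdX_eq h p.1 p.2
  unfold SmoothTwo
  rw [this]
  exact (smooth_fderiv h).clm_apply contDiff_const

lemma smooth_pdT {f : ℝ → ℝ → ℝ} (h : SmoothTwo f) : SmoothTwo (pdT f) := by
  have : (fun p : ℝ × ℝ => pdT f p.1 p.2) =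
      fun p => fderiv ℝ (fun p : ℝ × ℝ => f p.1 p.2) p (0, 1) := by
    funext p; exact pdT_eq h p.1 p.2
  unfold SmoothTwo
  rw [this]
  exact (smooth_fderiv h).clm_apply contDiff_const

lemma pd_comm {f : ℝ → ℝ → ℝ} (h : SmoothTwo f) (x t : ℝ) :
    pdT (pdX f) x t = pdX (pdT f) x t := by
  rw [pdT_eq (smooth_pdX h), pdX_eq (smooth_pdT h)]
  have e1 : (fun p : ℝ × ℝ => pdX f p.1 p.2) =
      fun p => fderiv ℝ (fun p : ℝ × ℝ => f p.1 p.2) p (1, 0) := by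
    funext p; exact pdX_eq h p.1 p.2
  have e2 : (fun p : ℝ × ℝ => pdT f p.1 p.2) =
      fun p => fderiv ℝ (fun p : ℝ × ℝ => f p.1 p.2) p (0, 1) := by
    funext p; exact pdT_eq h p.1 p.2
  have hd : DifferentiableAt ℝ (fderiv ℝ (fun p : ℝ × ℝ => f p.1 p.2)) (x, t) :=
    (smooth_fderiv h).differentiable (by simp) _
  rw [e1, e2, fderiv_clm_apply hd (by fun_prop), fderiv_clm_apply hd (by fun_prop)]
  have hs := (ContDiff.contDiffAt h (x := (x, t))).isSymmSndFDerivAt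
    (by
      simp only [minSmoothness_of_isRCLikeNormedField]
      exact WithTop.coe_le_coe.2 (le_top : (2 : ℕ∞) ≤ ⊤))
  simpa using hs (0, 1) (1, 0)

lemma SmoothTwo.cont {f : ℝ → ℝ → ℝ} (h : SmoothTwo f) :
    Continuous (fun p : ℝ × ℝ => f p.1 p.2) := ContDiff.continuous h

/-- Differentiation under the integral sign. -/
lemma hasDeriv_int {H H' : ℝ → ℝ → ℝ} (L : ℝ)
    (hc : ∀ t, Continuous (fun x => H x t))
    (hc' : Continuous (fun p : ℝ × ℝ => H' p.1 p.2))
    (hd : ∀ x t, HasDerivAt (fun s => H x s) (H' x t) t) (t : ℝ) :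
    HasDerivAt (fun t => ∫ x in (0 : ℝ)..L, H x t) (∫ x in (0 : ℝ)..L, H' x t) t := by
  obtain ⟨C, hC⟩ := ((isCompact_uIcc (a := (0 : ℝ)) (b := L)).prod
    (isCompact_Icc (a := t - 1) (b := t + 1))).exists_bound_of_continuousOn hc'.continuousOn
  refine (intervalIntegral.hasDerivAt_integral_of_dominated_loc_of_deriv_le
    (F := fun t x => H x t) (F' := fun t x => H' x t) (bound := fun _ => C)
    (s := Set.Icc (t - 1) (t + 1))
    (Icc_mem_nhds (by linarith) (by linarith)) ?_ ?_ ?_ ?_ ?_ ?_).2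
  · exact Filter.Eventually.of_forall fun s => (hc s).aestronglyMeasurable
  · exact (hc t).intervalIntegrable _ _
  · exact (hc'.comp (by fun_prop : Continuous fun x : ℝ => (x, t))).aestronglyMeasurable
  · exact Filter.Eventually.of_forall fun x hx s hs =>
      hC (x, s) ⟨Set.uIoc_subset_uIcc hx, hs⟩
  · exact intervalIntegrable_const
  · exact Filter.Eventually.of_forall fun x _ s _ => hd x s

/-- Derivative of the delay term. -/
lemma hasDeriv_delay {g : ℝ → ℝ} (hg : Continuous g) {τ : ℝ} (hτ : 0 < τ) (t : ℝ) :
    HasDerivAt (fun t => ∫ ρ in (0 : ℝ)..1, g (t - τ * ρ)) ((g t - g (t - τ)) / τ) t := by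
  have e : (fun t => ∫ ρ in (0 : ℝ)..1, g (t - τ * ρ)) =
      fun t => ((∫ s in (0 : ℝ)..t, g s) - ∫ s in (0 : ℝ)..(t - τ), g s) / τ := by
    funext t
    rw [intervalIntegral.integral_comp_sub_mul g hτ.ne' t,
      intervalIntegral.integral_interval_sub_left (hg.intervalIntegrable _ _)
      (hg.intervalIntegrable _ _)]
    simp [div_eq_inv_mul]
  rw [e]
  have h1 : ∀ s, HasDerivAt (fun t => ∫ s in (0 : ℝ)..t, g s) (g s) s := fun s =>
    hg.integral_hasStrictDerivAt 0 s |>.hasDerivAt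
  exact ((h1 t).sub ((h1 (t - τ)).comp_sub_const t τ)).div_const τ

lemma quad {τ a κ ξ : ℝ} (hτ : 0 < τ) (hκ : 0 < κ) (hκa : κ ≤ a)
    (hξ₁ : τ * (a - Real.sqrt (a ^ 2 - κ ^ 2)) ≤ ξ)
    (hξ₂ : ξ ≤ τ * (a + Real.sqrt (a ^ 2 - κ ^ 2))) (p q : ℝ) :
    0 ≤ 2 * a * p ^ 2 + 2 * κ * (p * q) - ξ * ((p ^ 2 - q ^ 2) / τ) := by
  obtain ⟨z, rfl⟩ : ∃ z, ξ = τ * z := ⟨ξ / τ, by field_simp⟩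
  have h1 := le_of_mul_le_mul_left hξ₁ hτ
  have h2 := le_of_mul_le_mul_left hξ₂ hτ
  have hs := Real.sq_sqrt (show 0 ≤ a ^ 2 - κ ^ 2 by nlinarith)
  have hs0 := Real.sqrt_nonneg (a ^ 2 - κ ^ 2)
  set r := Real.sqrt (a ^ 2 - κ ^ 2)
  have hz : κ ^ 2 ≤ z * (2 * a - z) := by nlinarith
  have hra : r < a := by nlinarith
  have hz0 : 0 < z := by linarith
  have e : τ * z * ((p ^ 2 - q ^ 2) / τ) = z * (p ^ 2 - q ^ 2) := by field_simp
  rw [e]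
  have : 0 ≤ z * (2 * a * p ^ 2 + 2 * κ * (p * q) - z * (p ^ 2 - q ^ 2)) := by
    nlinarith [sq_nonneg (z * q + κ * p), mul_nonneg (sub_nonneg.2 hz) (sq_nonneg p)]
  exact nonneg_of_mul_nonneg_right this hz0

/-- If `0 < κ ≤ a` and `ξ ∈ J_{a,κ,τ}`, the energy of the thermoelastic string
with delayed heat conduction is nonincreasing on `[0,∞)`. -/
theorem energy_nonincreasing_DHstring
    (L τ a κ ξ : ℝ) (hL : 0 < L) (hτ : 0 < τ) (hκ : 0 < κ) (hκa : κ ≤ a)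
    (hξ₁ : τ * (a - Real.sqrt (a ^ 2 - κ ^ 2)) ≤ ξ)
    (hξ₂ : ξ ≤ τ * (a + Real.sqrt (a ^ 2 - κ ^ 2)))
    (u θ : ℝ → ℝ → ℝ) (hsol : IsSmoothSolDelayedHeatString L τ a κ u θ) :
    AntitoneOn (energyDHString L τ ξ u θ) (Set.Ici (0 : ℝ)) := by
  obtain ⟨su, sθ, pu, pθ, bu, bθ⟩ := hsol
  change SmoothTwo u at su
  change SmoothTwo θ at sθ
  have sut := smooth_pdT su
  have sux := smooth_pdX su
  have sutt := smooth_pdT sut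
  have suxx := smooth_pdX sux
  have sutx := smooth_pdX sut
  have suxt := smooth_pdT sux
  have sθt := smooth_pdT sθ
  have sθx := smooth_pdX sθ
  have sθxx := smooth_pdX sθx
  have cx : ∀ {f : ℝ → ℝ → ℝ}, SmoothTwo f → ∀ t, Continuous (fun x => f x t) :=
    fun h t => h.cont.comp (by fun_prop : Continuous fun x : ℝ => (x, t))
  have ct : ∀ {f : ℝ → ℝ → ℝ}, SmoothTwo f → ∀ x, Continuous (fun t => f x t) :=
    fun h x => h.cont.comp (by fun_prop : Continuous fun t : ℝ => (x, t))
  have cd : Continuous (fun p : ℝ × ℝ => pdX θ p.1 (p.2 - τ)) :=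
    sθx.cont.comp (by fun_prop : Continuous fun p : ℝ × ℝ => (p.1, p.2 - τ))
  -- derivative of the energy
  have hE : ∀ t, HasDerivAt (energyDHString L τ ξ u θ)
      ((1 / 2) * ((∫ x in (0 : ℝ)..L, (2 * pdT u x t * pdT (pdT u) x t
        + 2 * pdX u x t * pdT (pdX u) x t + 2 * θ x t * pdT θ x t))
        + ξ * ∫ x in (0 : ℝ)..L,
          ((pdX θ x t) ^ 2 - (pdX θ x (t - τ)) ^ 2) / τ)) t := by
    intro t
    have A := hasDeriv_int (H := fun x t => (pdT u x t) ^ 2 + (pdX u x t) ^ 2 + (θ x t) ^ 2)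
      (H' := fun x t => 2 * pdT u x t * pdT (pdT u) x t
        + 2 * pdX u x t * pdT (pdX u) x t + 2 * θ x t * pdT θ x t) L
      (fun t => by
        have := cx sut t
        have := cx sux t
        have := cx sθ t
        fun_prop)
      (by
        have := sut.cont
        have := sutt.cont
        have := sux.cont
        have := suxt.cont
        have := sθ.cont
        have := sθt.cont
        fun_prop)
      (fun x t => by
        refine ((((hasPdT sut x t).pow 2).add ((hasPdT sux x t).pow 2)).add
          ((hasPdT sθ x t).pow 2)).congr_deriv ?_
        simp) t
    have B := hasDeriv_int
      (H := fun x t => ∫ ρ in (0 : ℝ)..(1 : ℝ), (pdX θ x (t - τ * ρ)) ^ 2)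
      (H' := fun x t => ((pdX θ x t) ^ 2 - (pdX θ x (t - τ)) ^ 2) / τ) L
      (fun t => by
        apply intervalIntegral.continuous_parametric_intervalIntegral_of_continuous'
        exact (sθx.cont.comp
          (by fun_prop : Continuous fun p : ℝ × ℝ => (p.1, t - τ * p.2))).pow 2)
      (by
        have := sθx.cont
        fun_prop)
      (fun x t => hasDeriv_delay (g := fun s => (pdX θ x s) ^ 2) ((ct sθx x).pow 2) hτ t) t
    exact (A.add (B.const_mul ξ)).const_mul (1 / 2)
  refine antitoneOn_of_deriv_nonpos (convex_Ici 0)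
    (fun t _ => (hE t).continuousAt.continuousWithinAt)
    (fun t _ => (hE t).differentiableAt.differentiableWithinAt) ?_
  intro t ht
  rw [interior_Ici, Set.mem_Ioi] at ht
  rw [(hE t).deriv]
  have but : ∀ y, (∀ s, 0 ≤ s → u y s = 0) → pdT u y t = 0 := by
    intro y hy
    have : (fun s => u y s) =ᶠ[nhds t] fun _ => (0 : ℝ) := by
      filter_upwards [lt_mem_nhds ht] with s hs using hy s hs.le
    rw [pdT, this.deriv_eq]
    simp
  have b0 := but 0 fun s hs => (bu s hs).1
  have bL := but L fun s hs => (bu s hs).2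
  have c0 := bθ t (by linarith)
  -- flux
  have hflux : ∫ x in (0 : ℝ)..L,
      ((pdX (pdT u) x t * pdX u x t + pdT u x t * pdX (pdX u) x t)
        - (pdX (pdT u) x t * θ x t + pdT u x t * pdX θ x t)
        + (pdX θ x t * (κ * pdX θ x (t - τ) + a * pdX θ x t)
          + θ x t * (κ * pdX (pdX θ) x (t - τ) + a * pdX (pdX θ) x t))) = 0 := by
    rw [intervalIntegral.integral_eq_sub_of_hasDerivAt
      (f := fun x => pdT u x t * pdX u x t - pdT u x t * θ x t
        + θ x t * (κ * pdX θ x (t - τ) + a * pdX θ x t))]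
    · simp [b0, bL, c0.1, c0.2]
    · intro x _
      exact (((hasPdX sut x t).mul (hasPdX sux x t)).sub
        ((hasPdX sut x t).mul (hasPdX sθ x t))).add ((hasPdX sθ x t).mul
        (((hasPdX sθx x (t - τ)).const_mul κ).add ((hasPdX sθx x t).const_mul a)))
    · apply Continuous.intervalIntegrable
      have := cx sut t
      have := cx sutx t
      have := cx sux t
      have := cx suxx t
      have := cx sθ t
      have := cx sθx t
      have := cx sθx (t - τ)
      have := cx sθxx t
      have := cx sθxx (t - τ)
      fun_prop
  have iQ : IntervalIntegrable (fun x => 2 * a * (pdX θ x t) ^ 2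
        + 2 * κ * (pdX θ x t * pdX θ x (t - τ))) volume 0 L := by
    apply Continuous.intervalIntegrable
    have := cx sθx t
    have := cx sθx (t - τ)
    fun_prop
  have iR : IntervalIntegrable
      (fun x => ξ * (((pdX θ x t) ^ 2 - (pdX θ x (t - τ)) ^ 2) / τ)) volume 0 L := by
    apply Continuous.intervalIntegrable
    have := cx sθx t
    have := cx sθx (t - τ)
    fun_prop
  have hA : ∫ x in (0 : ℝ)..L, (2 * pdT u x t * pdT (pdT u) x t
        + 2 * pdX u x t * pdT (pdX u) x t + 2 * θ x t * pdT θ x t)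
      = -∫ x in (0 : ℝ)..L, (2 * a * (pdX θ x t) ^ 2
        + 2 * κ * (pdX θ x t * pdX θ x (t - τ))) := by
    rw [eq_neg_iff_add_eq_zero, ← intervalIntegral.integral_add]
    · refine Eq.trans ?_ ((congrArg (fun z : ℝ => 2 * z) hflux).trans (mul_zero 2))
      simp only [← intervalIntegral.integral_const_mul]
      refine intervalIntegral.integral_congr_Ioo_of_le hL.le ?_
      intro x hx
      have e1 := pu x hx t ht
      have e2 := pθ x hx t ht
      have e3 := pd_comm su x t
      simp only
      rw [e3]
      linear_combination (2 * pdT u x t) * e1 + (2 * θ x t) * e2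
    · apply Continuous.intervalIntegrable
      have := cx sut t
      have := cx sutt t
      have := cx sux t
      have := cx suxt t
      have := cx sθ t
      have := cx sθt t
      fun_prop
    · exact iQ
  rw [hA, ← intervalIntegral.integral_const_mul]
  have hpos : 0 ≤ ∫ x in (0 : ℝ)..L, ((2 * a * (pdX θ x t) ^ 2
      + 2 * κ * (pdX θ x t * pdX θ x (t - τ)))
      - ξ * (((pdX θ x t) ^ 2 - (pdX θ x (t - τ)) ^ 2) / τ)) :=
    intervalIntegral.integral_nonneg hL.le fun x _ => quad hτ hκ hκa hξ₁ hξ₂ _ _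
  rw [intervalIntegral.integral_sub iQ iR] at hpos
  linarith
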